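/- Let x = (x_0, ..., x_n) be a tuple of positive integers with weights w = (q_0, ..., q_n) satisfying q_0 < q_1 < ... < q_n, and define y_i = gcd(x_i, x_{i+1}, ..., x_n) for i = 0, ..., n. Then wgcd_w(x_0, ..., x_n) = wgcd_w(y_0, y_1, ..., y_n), and moreover the tuple (y_0, ..., y_n) is nondecreasing: y_0 ≤ y_1 ≤ ... ≤ y_n. -/

import Mathlib

/-- The weighted greatest common divisor of a tuple `x` of integers with respect to
weights `w`: the largest positive integer `d` such that `d ^ (w i) ∣ x i` for all `i`. -/
noncomputable def wgcd {n : ℕ} (w : Fin n → ℕ) (x : Fin n → ℤ) : ℕ :=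
  sSup {d : ℕ | 0 < d ∧ ∀ i, (d : ℤ) ^ (w i) ∣ x i}

/-- For monotone weights, the powers `d ^ w i` divide all coordinates iff they divide the gcds
of all tails. -/
theorem forall_pow_dvd_gcd_Ici_iff {ι : Type*} [Preorder ι] [LocallyFiniteOrderTop ι]
    {w : ι → ℕ} (hw : Monotone w) (x : ι → ℤ) (d : ℤ) :
    (∀ i, d ^ w i ∣ (Finset.Ici i).gcd x) ↔ ∀ i, d ^ w i ∣ x i :=
  ⟨fun h i => (h i).trans (Finset.gcd_dvd (Finset.mem_Ici.2 le_rfl)),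
    fun h _ => Finset.dvd_gcd fun j hj =>
      (pow_dvd_pow d (hw (Finset.mem_Ici.1 hj))).trans (h j)⟩

/-- The gcds of the tails of a family of nonzero integers are nondecreasing. -/
theorem monotone_gcd_Ici {ι : Type*} [Preorder ι] [LocallyFiniteOrderTop ι]
    {x : ι → ℤ} (hx : ∀ i, x i ≠ 0) : Monotone fun i => (Finset.Ici i).gcd x := by
  intro _ j hij
  have hne : (Finset.Ici j).gcd x ≠ 0 := fun h =>
    hx j (Finset.gcd_eq_zero_iff.1 h j (Finset.mem_Ici.2 le_rfl))
  have hnonneg : 0 ≤ (Finset.Ici j).gcd x :=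
    Int.nonneg_of_normalize_eq_self Finset.normalize_gcd
  exact Int.le_of_dvd (lt_of_le_of_ne hnonneg hne.symm)
    (Finset.gcd_mono (Finset.Ici_subset_Ici.2 hij))

/-- for a tuple of positive integers with strictly increasing weights,
replacing each coordinate by the gcd of its tail segment does not change the weighted
gcd, and the resulting tuple is nondecreasing. -/
theorem wgcd_tails_monotone (n : ℕ) (x : Fin (n + 1) → ℤ) (w : Fin (n + 1) → ℕ)
    (hw₀ : ∀ i, 0 < w i) (hw : StrictMono w) (hx : ∀ i, 0 < x i)
    (y : Fin (n + 1) → ℤ) (hy : ∀ i, y i = (Finset.Ici i).gcd x) :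
    wgcd w x = wgcd w y ∧ Monotone y := by
  obtain rfl : y = fun i => (Finset.Ici i).gcd x := funext hy
  refine ⟨?_, monotone_gcd_Ici fun i => (hx i).ne'⟩
  simp only [wgcd, forall_pow_dvd_gcd_Ici_iff hw.monotone]
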